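/- arXiv:1509.03800 — 3 statements merged into one kernel-verified Lean document; each statement's English description precedes it below -/
import Mathlib

section
/- (Theorem 2) Let (V, G, B) be a group divisible design in which every block has exactly d points, and view the blocks B₁, …, B_n of B as storage nodes, each storing the d packets indexed by its points. Then for every k with 1 ≤ k ≤ n and every subset K of {1, …, n} with |K| = k, the number of distinct packets obtained from the nodes in K satisfies |⋃_{i∈K} B_i| ≥ kd − k(k−1)/2; that is, the code achieves the MBR system storage capacity C_MBR = kd − C(k,2) under random access to any k nodes. -/
/-- **Theorem 2.** Let `(V, G, B)` be a group divisible design in which every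
block has exactly `d` points, and view the blocks `B₁, …, Bₙ` as storage nodes. Then for
every `k` with `1 ≤ k ≤ n` and every `k`-subset `K` of the node indices, the number of
distinct packets obtained from the nodes in `K` satisfies
`|⋃_{i ∈ K} Bᵢ| ≥ k·d − C(k,2)`, i.e. the code achieves the MBR system storage capacity
`C_MBR = k·d − C(k,2)` under random access to any `k` nodes. -/
theorem gdd_code_achieves_MBR_capacity
    {α γ : Type*} [DecidableEq α] {n d : ℕ}
    (V : Finset α) (Grp : γ → Finset α) (Bl : Fin n → Finset α)
    -- the groups are subsets of `V` and partition `V`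
    (hGsub : ∀ g : γ, Grp g ⊆ V)
    (hGpart : ∀ p ∈ V, ∃! g : γ, p ∈ Grp g)
    -- there are at least two (nonempty) groups
    (hGtwo : ∃ g g' : γ, (Grp g).Nonempty ∧ (Grp g').Nonempty ∧ Grp g ≠ Grp g')
    -- the blocks are subsets of `V`
    (hBsub : ∀ i : Fin n, Bl i ⊆ V)
    -- every block has exactly `d` points
    (hBcard : ∀ i : Fin n, (Bl i).card = d)
    -- every block intersects every group in at most one point
    (hBG : ∀ (i : Fin n) (g : γ), (Bl i ∩ Grp g).card ≤ 1)
    -- every pair of points from distinct groups is contained in exactly one block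
    (hpair : ∀ p ∈ V, ∀ q ∈ V, p ≠ q → (∀ g : γ, ¬(p ∈ Grp g ∧ q ∈ Grp g)) →
      ∃! i : Fin n, p ∈ Bl i ∧ q ∈ Bl i) :
    ∀ k : ℕ, 1 ≤ k → k ≤ n → ∀ K : Finset (Fin n), K.card = k →
      (k : ℤ) * d - (k.choose 2 : ℤ) ≤ ((K.biUnion Bl).card : ℤ) := by
  have hint : ∀ i j : Fin n, i ≠ j → (Bl i ∩ Bl j).card ≤ 1 := by
    intro i j hij
    rw [Finset.card_le_one]
    intro p hp q hq
    by_contra hpq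
    rw [Finset.mem_inter] at hp hq
    have hg : ∀ g : γ, ¬(p ∈ Grp g ∧ q ∈ Grp g) := by
      rintro g ⟨hpg, hqg⟩
      exact hpq (Finset.card_le_one.mp (hBG i g) p (Finset.mem_inter.mpr ⟨hp.1, hpg⟩) q
        (Finset.mem_inter.mpr ⟨hq.1, hqg⟩))
    exact hij ((hpair p (hBsub i hp.1) q (hBsub i hq.1) hpq hg).unique
      ⟨hp.1, hq.1⟩ ⟨hp.2, hq.2⟩)
  have key : ∀ K : Finset (Fin n),
      K.card * d ≤ (K.biUnion Bl).card + K.card.choose 2 := by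
    intro K
    induction K using Finset.induction_on with
    | empty => simp
    | insert a K ha ih =>
      rw [Finset.card_insert_of_notMem ha, Finset.biUnion_insert]
      have h1 := Finset.card_union_add_card_inter (Bl a) (K.biUnion Bl)
      have h2 : (Bl a ∩ K.biUnion Bl).card ≤ K.card := by
        rw [Finset.inter_biUnion]
        refine (Finset.card_biUnion_le_card_mul K _ 1 ?_).trans (by simp)
        intro j hj
        exact hint a j (fun h => ha (h ▸ hj))
      have h3 : (K.card + 1).choose 2 = K.card + K.card.choose 2 := by
        rw [Nat.choose_succ_succ' K.card 1, Nat.choose_one_right]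
      rw [h3, add_mul, one_mul]
      have h4 := hBcard a
      omega
  intro k _ _ K hK
  have h := key K
  rw [hK] at h
  have h' : (k : ℤ) * d ≤ ((K.biUnion Bl).card : ℤ) + (k.choose 2 : ℤ) := by exact_mod_cast h
  linarith
end

section
/- Let ξ₁, …, ξ_n be subsets of [φ] = {1, …, φ}, let Φ₁, …, Φ_λ be a partition of [φ], and suppose that for each j ∈ {1, …, λ} every point of Φ_j belongs to exactly ρ_j of the subsets ξ₁, …, ξ_n, where 1 ≤ ρ_j ≤ n. Then for every k with 1 ≤ k ≤ n, the quantity S(k) = min over all K ⊆ {1,…,n} with |K| = k of |⋃_{i∈K} ξ_i| satisfies S(k) ≤ ⌊ ∑_{j=1}^{λ} |Φ_j| (1 − C(n−ρ_j, k)/C(n, k)) ⌋, where C(a,b) denotes the binomial coefficient. -/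
/-- The number of `k`-subsets whose union misses `p`. -/
lemma card_miss {φ n : ℕ} (ξ : Fin n → Finset (Fin φ)) (p : Fin φ) (k r : ℕ)
    (h : (Finset.univ.filter fun i : Fin n => p ∈ ξ i).card = r) :
    ((Finset.powersetCard k (Finset.univ : Finset (Fin n))).filter
      fun K => ¬ p ∈ K.biUnion ξ).card = (n - r).choose k := by
  have h1 : (Finset.powersetCard k (Finset.univ : Finset (Fin n))).filter
      (fun K => ¬ p ∈ K.biUnion ξ) =
      Finset.powersetCard k (Finset.univ.filter fun i : Fin n => ¬ p ∈ ξ i) := by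
    ext K
    simp only [Finset.mem_filter, Finset.mem_powersetCard, Finset.mem_biUnion,
      Finset.subset_iff, Finset.mem_univ, true_and, not_exists, not_and, implies_true]
    tauto
  have h2 := Finset.card_filter_add_card_filter_not (s := (Finset.univ : Finset (Fin n)))
    (fun i : Fin n => p ∈ ξ i)
  rw [Finset.card_univ, Fintype.card_fin] at h2
  rw [h1, Finset.card_powersetCard]
  congr 1
  omega

/-- Let `ξ₁, …, ξₙ` be subsets of `[φ]`, let `Φ₁, …, Φ_λ` be a partition
of `[φ]`, and suppose every point of `Φⱼ` belongs to exactly `ρⱼ` of the subsets, with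
`1 ≤ ρⱼ ≤ n`. Then for every `1 ≤ k ≤ n` the quantity
`S(k) = min_{K ⊆ [n], |K| = k} |⋃_{i ∈ K} ξᵢ|` satisfies
`S(k) ≤ ⌊ ∑ⱼ |Φⱼ| (1 − C(n−ρⱼ, k)/C(n, k)) ⌋`; equivalently, there is a `k`-subset `K`
whose union has at most that many points. -/
theorem hfr_capacity_upper_bound
    {φ n lam : ℕ} (ξ : Fin n → Finset (Fin φ))
    (Φ : Fin lam → Finset (Fin φ)) (ρ : Fin lam → ℕ)
    -- `Φ₁, …, Φ_λ` is a partition of `[φ]`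
    (hpart : ∀ p : Fin φ, ∃! l : Fin lam, p ∈ Φ l)
    -- `1 ≤ ρⱼ ≤ n`
    (hρ : ∀ l : Fin lam, 1 ≤ ρ l ∧ ρ l ≤ n)
    -- every point of `Φⱼ` belongs to exactly `ρⱼ` of the subsets
    (hrep : ∀ l : Fin lam, ∀ p ∈ Φ l,
      (Finset.univ.filter fun i : Fin n => p ∈ ξ i).card = ρ l) :
    ∀ k : ℕ, 1 ≤ k → k ≤ n →
      ∃ K : Finset (Fin n), K.card = k ∧
        ((K.biUnion ξ).card : ℤ) ≤
          ⌊∑ l : Fin lam, ((Φ l).card : ℚ) *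
              (1 - ((n - ρ l).choose k : ℚ) / (n.choose k : ℚ))⌋ := by
  intro k _ hkn
  set P := Finset.powersetCard k (Finset.univ : Finset (Fin n)) with hP
  have hPc : P.card = n.choose k := by simp [hP]
  have hpos : (0 : ℚ) < n.choose k := by exact_mod_cast Nat.choose_pos hkn
  have hne : P.Nonempty := by
    rw [← Finset.card_pos, hPc]; exact Nat.choose_pos hkn
  set B : ℚ := ∑ l : Fin lam, ((Φ l).card : ℚ) *
              (1 - ((n - ρ l).choose k : ℚ) / (n.choose k : ℚ)) with hB
  have hpt : ∀ l, ∀ p ∈ Φ l, (∑ K ∈ P, if p ∈ K.biUnion ξ then (1 : ℚ) else 0) =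
      (n.choose k : ℚ) * (1 - ((n - ρ l).choose k : ℚ) / (n.choose k : ℚ)) := by
    intro l p hp
    have h1 := card_miss ξ p k (ρ l) (hrep l p hp)
    have h2 := Finset.card_filter_add_card_filter_not (s := P) (fun K => p ∈ K.biUnion ξ)
    rw [h1, hPc] at h2
    rw [Finset.sum_boole, mul_sub, mul_div_cancel₀ _ hpos.ne', mul_one, ← h2]
    push_cast
    ring
  have hsplit : ∀ f : Fin φ → ℚ, ∑ p, f p = ∑ l, ∑ p ∈ Φ l, f p := by
    intro f
    have hu : (Finset.univ : Finset (Fin φ)) = Finset.univ.biUnion Φ := by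
      ext p
      obtain ⟨l, hl, _⟩ := hpart p
      simp only [Finset.mem_univ, Finset.mem_biUnion, true_and, true_iff]
      exact ⟨l, hl⟩
    rw [hu, Finset.sum_biUnion]
    intro a _ b _ hab
    rw [Function.onFun, Finset.disjoint_left]
    intro p hpa hpb
    exact hab ((hpart p).unique hpa hpb)
  have hsum : ∑ K ∈ P, ((K.biUnion ξ).card : ℚ) = ∑ _K ∈ P, B := by
    have h1 : ∀ K : Finset (Fin n), ((K.biUnion ξ).card : ℚ) =
        ∑ p, if p ∈ K.biUnion ξ then (1 : ℚ) else 0 := by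
      intro K
      rw [Finset.sum_boole, Finset.filter_univ_mem]
    rw [Finset.sum_congr rfl fun K _ => h1 K, Finset.sum_comm, hsplit, Finset.sum_const,
      hPc, nsmul_eq_mul, hB, Finset.mul_sum]
    refine Finset.sum_congr rfl fun l _ => ?_
    rw [Finset.sum_congr rfl (hpt l), Finset.sum_const, nsmul_eq_mul]
    ring
  obtain ⟨K, hK, hle⟩ := Finset.exists_le_of_sum_le hne hsum.le
  refine ⟨K, (Finset.mem_powersetCard.1 hK).2, ?_⟩
  rw [Int.le_floor]
  exact_mod_cast hle
end

section
/- Let (V, G, B) be a ψ-GDD of type θ₁^{u₁}⋯θ_λ^{u_λ} with ψ ≥ 2, v = u₁θ₁ + ⋯ + u_λθ_λ, and suppose the values ρ_l = (v − θ_l)/(ψ − 1), l = 1, …, λ, are pairwise distinct positive integers. For each l let Φ_l denote the union of the groups of size θ_l. Then the blocks of B, viewed as subsets ξ₁, …, ξ_n of V, form a λ-HFR code with node capacity d = ψ: (i) |ξ_i| = ψ for all i; (ii) each point of Φ_l belongs to exactly ρ_l of the blocks; and (iii) |ξ_i ∩ ξ_j| ≤ 1 for all i ≠ j. -/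
/-- Let `(V, G, B)` be a `ψ`-GDD of type `θ₁^{u₁} ⋯ θ_λ^{u_λ}` with
`ψ ≥ 2` and `v = u₁θ₁ + ⋯ + u_λθ_λ`, and suppose the values `ρ_l = (v − θ_l)/(ψ − 1)` are
pairwise distinct positive integers. Letting `Φ_l` be the union of the groups of size
`θ_l`, the blocks of `B` form a `λ`-HFR code with node capacity `d = ψ`:
(i) every block has exactly `ψ` points; (ii) each point of `Φ_l` (i.e. each point lying
in a group of size `θ_l`) belongs to exactly `ρ_l` blocks; (iii) any two distinct blocks
share at most one point. -/
theorem gdd_gives_hfr_code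
    {α γ ι : Type*} [DecidableEq α] [Fintype γ] [Fintype ι]
    {lam : ℕ} (V : Finset α) (Grp : γ → Finset α) (Bl : ι → Finset α)
    (ψ : ℕ) (θ u ρ : Fin lam → ℕ)
    (hψ : 2 ≤ ψ)
    -- the groups are subsets of `V` and partition `V`
    (hGsub : ∀ g : γ, Grp g ⊆ V)
    (hGpart : ∀ p ∈ V, ∃! g : γ, p ∈ Grp g)
    -- there are at least two (nonempty) groups
    (hGtwo : ∃ g g' : γ, (Grp g).Nonempty ∧ (Grp g').Nonempty ∧ Grp g ≠ Grp g')
    -- the blocks are subsets of `V`, each of exactly `ψ` points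
    (hBsub : ∀ i : ι, Bl i ⊆ V)
    (hBcard : ∀ i : ι, (Bl i).card = ψ)
    -- every block intersects every group in at most one point
    (hBG : ∀ (i : ι) (g : γ), (Bl i ∩ Grp g).card ≤ 1)
    -- every pair of points from distinct groups is contained in exactly one block
    (hpair : ∀ p ∈ V, ∀ q ∈ V, p ≠ q → (∀ g : γ, ¬(p ∈ Grp g ∧ q ∈ Grp g)) →
      ∃! i : ι, p ∈ Bl i ∧ q ∈ Bl i)
    -- the design has type `θ₁^{u₁} ⋯ θ_λ^{u_λ}`
    (hθdist : Function.Injective θ)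
    (hsizes : ∀ g : γ, ∃ l : Fin lam, (Grp g).card = θ l)
    (hcount : ∀ l : Fin lam,
      (Finset.univ.filter fun g : γ => (Grp g).card = θ l).card = u l)
    -- `v = u₁θ₁ + ⋯ + u_λθ_λ`
    (hv : V.card = ∑ l : Fin lam, u l * θ l)
    -- `ρ_l = (v − θ_l)/(ψ − 1)` are pairwise distinct positive integers
    (hρ : ∀ l : Fin lam, ρ l = (V.card - θ l) / (ψ - 1))
    (hρdist : Function.Injective ρ)
    (hρpos : ∀ l : Fin lam, 0 < ρ l) :
    -- (i) every block (node) stores exactly `d = ψ` packets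
    (∀ i : ι, (Bl i).card = ψ) ∧
    -- (ii) each point of `Φ_l` belongs to exactly `ρ_l` blocks
    (∀ l : Fin lam, ∀ p : α, ∀ g : γ, p ∈ Grp g → (Grp g).card = θ l →
      (Finset.univ.filter fun i : ι => p ∈ Bl i).card = ρ l) ∧
    -- (iii) any two distinct blocks intersect in at most one point
    (∀ i j : ι, i ≠ j → (Bl i ∩ Bl j).card ≤ 1) := by
  classical
  -- two points of a common block never lie in a common group
  have hsep : ∀ (i : ι) (p q : α), p ∈ Bl i → q ∈ Bl i → p ≠ q →
      ∀ g : γ, ¬(p ∈ Grp g ∧ q ∈ Grp g) := by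
    intro i p q hp hq hne g hg
    exact hne (Finset.card_le_one.mp (hBG i g) p (Finset.mem_inter.mpr ⟨hp, hg.1⟩) q
      (Finset.mem_inter.mpr ⟨hq, hg.2⟩))
  have huniq : ∀ (i j : ι) (p q : α), p ∈ Bl i → q ∈ Bl i → p ∈ Bl j → q ∈ Bl j →
      p ≠ q → i = j := by
    intro i j p q hpi hqi hpj hqj hne
    exact (hpair p (hBsub i hpi) q (hBsub i hqi) hne (hsep i p q hpi hqi hne)).unique
      ⟨hpi, hqi⟩ ⟨hpj, hqj⟩
  refine ⟨hBcard, ?_, ?_⟩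
  · intro l p g hpg hg
    have hpV := hGsub g hpg
    -- the blocks through `p`, with `p` removed, partition `V \ Grp g`
    have hU : V \ Grp g =
        (Finset.univ.filter fun i : ι => p ∈ Bl i).biUnion fun i => (Bl i).erase p := by
      ext q
      simp only [Finset.mem_sdiff, Finset.mem_biUnion, Finset.mem_filter, Finset.mem_univ,
        true_and, Finset.mem_erase]
      constructor
      · rintro ⟨hqV, hqg⟩
        have hne : p ≠ q := fun h => hqg (h ▸ hpg)
        obtain ⟨i, hi, -⟩ := hpair p hpV q hqV hne (by
          rintro g' ⟨h1, h2⟩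
          have : g' = g := (hGpart p hpV).unique h1 hpg
          exact hqg (this ▸ h2))
        exact ⟨i, hi.1, hne.symm, hi.2⟩
      · rintro ⟨i, hpi, hne, hqi⟩
        exact ⟨hBsub i hqi, fun h => hsep i p q hpi hqi hne.symm g ⟨hpg, h⟩⟩
    have hcard : V.card - θ l =
        (Finset.univ.filter fun i : ι => p ∈ Bl i).card * (ψ - 1) := by
      rw [← hg, ← Finset.card_sdiff_of_subset (hGsub g), hU, Finset.card_biUnion]
      · apply Finset.sum_const_nat
        intro i hi
        rw [Finset.card_erase_of_mem (Finset.mem_filter.mp hi).2, hBcard]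
      · intro i hi j hj hij
        rw [Function.onFun, Finset.disjoint_left]
        rw [Finset.mem_coe] at hi hj
        intro q hq hq'
        rw [Finset.mem_erase] at hq hq'
        exact hij (huniq i j p q (Finset.mem_filter.mp hi).2 hq.2
          (Finset.mem_filter.mp hj).2 hq'.2 hq.1.symm)
    rw [hρ l, hcard, Nat.mul_div_cancel _ (by omega)]
  · intro i j hij
    rw [Finset.card_le_one]
    intro p hp q hq
    rw [Finset.mem_inter] at hp hq
    by_contra hne
    exact hij (huniq i j p q hp.1 hq.1 hp.2 hq.2 hne)
end
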